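/- arXiv:2210.05697 — 3 statements merged into one kernel-verified Lean document; each statement's English description precedes it below -/
import Mathlib

section
/- Let f : C → D be a morphism of bounded chain complexes of finitely generated free ℤ-modules. If for every prime p the induced map f ⊗ 𝔽̄_p is a quasi-isomorphism, and f ⊗ ℚ̄ is a quasi-isomorphism, then f is a quasi-isomorphism. -/
open CategoryTheory

universe v u

section Nakayama

variable {R M : Type*} [CommRing R] [AddCommGroup M] [Module R M]

/-- A local-to-global form of Nakayama's lemma. -/
theorem Submodule.FG.le_of_forall_isMaximal_le_sup_smul
    {N N' : Submodule R M} (hN : N.FG)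
    (h : ∀ I : Ideal R, I.IsMaximal → N ≤ N' ⊔ I • N) : N ≤ N' := by
  by_contra hne
  obtain ⟨I, hI, hle⟩ := Ideal.exists_le_maximal (N'.colon (N : Set M)) (by
    rw [Ne, Ideal.eq_top_iff_one, Submodule.mem_colon]
    simpa [SetLike.le_def] using hne)
  obtain ⟨r, hr, hrN⟩ := Submodule.exists_sub_one_mem_and_smul_le_of_fg_of_le_sup hN le_rfl (h I hI)
  refine hI.ne_top ((Ideal.eq_top_iff_one _).2 ?_)
  have hrI : r ∈ I := hle (Submodule.mem_colon.2 fun x hx =>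
    hrN (Submodule.smul_mem_pointwise_smul x r N hx))
  simpa using sub_mem hrI hr

end Nakayama

theorem Int.exists_prime_eq_span_of_isMaximal {I : Ideal ℤ} (hI : I.IsMaximal) :
    ∃ p : ℕ, p.Prime ∧ I = Ideal.span {(p : ℤ)} := by
  obtain ⟨a, rfl⟩ := (IsPrincipalIdealRing.principal I).principal
  have ha : a ≠ 0 := by
    rintro rfl
    exact Ring.ne_bot_of_isMaximal_of_not_isField hI Int.not_isField (by simp)
  refine ⟨a.natAbs, Int.prime_iff_natAbs_prime.1 ((Ideal.span_singleton_prime ha).1 hI.isPrime), ?_⟩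
  exact (Int.span_natAbs a).symm

namespace HomologicalComplex

variable {R : Type*} [Ring R] {ι : Type*} {c : ComplexShape ι}
  (K : HomologicalComplex (ModuleCat R) c)

theorem exists_iCycles_eq {i j : ι} (hj : c.next i = j) {x : K.X i} (hx : K.d i j x = 0) :
    ∃ z : K.cycles i, K.iCycles i z = x :=
  (ShortComplex.moduleCat_exact_iff _).1
    (ShortComplex.exact_of_f_is_kernel (.mk _ _ (K.iCycles_d i j)) (K.cyclesIsKernel i j hj)) x hx

theorem homologyπ_eq_zero_iff {i j : ι} (hi : c.prev j = i) (z : K.cycles j) :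
    K.homologyπ j z = 0 ↔ ∃ x : K.X i, K.d i j x = K.iCycles j z := by
  constructor
  · intro hz
    obtain ⟨x, rfl⟩ := (ShortComplex.moduleCat_exact_iff _).1
      (ShortComplex.exact_of_g_is_cokernel (.mk _ _ (K.toCycles_comp_homologyπ i j))
        (K.homologyIsCokernel i j hi)) z hz
    exact ⟨x, by simp [← ConcreteCategory.comp_apply]⟩
  · rintro ⟨x, hx⟩
    obtain rfl : K.toCycles i j x = z :=
      (ModuleCat.mono_iff_injective (K.iCycles j)).1 inferInstance (by
        rw [← hx, ← ConcreteCategory.comp_apply, toCycles_i])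
    rw [← ConcreteCategory.comp_apply, toCycles_comp_homologyπ]
    rfl

variable {K} {L : HomologicalComplex (ModuleCat R) c} (f : K ⟶ L)

theorem map_homologyπ (i : ι) (z : K.cycles i) :
    homologyMap f i (K.homologyπ i z) = L.homologyπ i (cyclesMap f i z) := by
  rw [← ConcreteCategory.comp_apply, homologyπ_naturality, ConcreteCategory.comp_apply]

theorem iCycles_cyclesMap (i : ι) (z : K.cycles i) :
    L.iCycles i (cyclesMap f i z) = f.f i (K.iCycles i z) := by
  rw [← ConcreteCategory.comp_apply, cyclesMap_i, ConcreteCategory.comp_apply]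

theorem injective_homologyMap_iff {i j k : ι} (hi : c.prev j = i) (hk : c.next j = k) :
    Function.Injective (homologyMap f j) ↔ ∀ (x : K.X j) (y : L.X i), K.d j k x = 0 →
      f.f j x = L.d i j y → ∃ x' : K.X i, x = K.d i j x' := by
  rw [injective_iff_map_eq_zero]
  constructor
  · intro h x y hx hxy
    obtain ⟨z, rfl⟩ := K.exists_iCycles_eq hk hx
    obtain ⟨x', hx'⟩ := (K.homologyπ_eq_zero_iff hi z).1 <| h _ <| by
      rw [map_homologyπ, L.homologyπ_eq_zero_iff hi]
      exact ⟨y, by rw [iCycles_cyclesMap, hxy]⟩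
    exact ⟨x', hx'.symm⟩
  · intro h a ha
    obtain ⟨z, rfl⟩ := (ModuleCat.epi_iff_surjective (K.homologyπ j)).1 inferInstance a
    rw [map_homologyπ, L.homologyπ_eq_zero_iff hi] at ha
    obtain ⟨y, hy⟩ := ha
    rw [iCycles_cyclesMap] at hy
    obtain ⟨x', hx'⟩ := h _ y (by simp [← ConcreteCategory.comp_apply]) hy.symm
    exact (K.homologyπ_eq_zero_iff hi z).2 ⟨x', hx'.symm⟩

theorem surjective_homologyMap_iff {i j k : ι} (hi : c.prev j = i) (hk : c.next j = k) :
    Function.Surjective (homologyMap f j) ↔ ∀ y : L.X j, L.d j k y = 0 →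
      ∃ (x : K.X j) (y' : L.X i), K.d j k x = 0 ∧ y = f.f j x + L.d i j y' := by
  constructor
  · intro h y hy
    obtain ⟨w, rfl⟩ := L.exists_iCycles_eq hk hy
    obtain ⟨a, ha⟩ := h (L.homologyπ j w)
    obtain ⟨z, rfl⟩ := (ModuleCat.epi_iff_surjective (K.homologyπ j)).1 inferInstance a
    rw [map_homologyπ, eq_comm, ← sub_eq_zero, ← map_sub, L.homologyπ_eq_zero_iff hi] at ha
    obtain ⟨y', hy'⟩ := ha
    refine ⟨K.iCycles j z, y', by simp [← ConcreteCategory.comp_apply], ?_⟩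
    rw [hy', map_sub, iCycles_cyclesMap, add_sub_cancel]
  · intro h b
    obtain ⟨w, rfl⟩ := (ModuleCat.epi_iff_surjective (L.homologyπ j)).1 inferInstance b
    obtain ⟨x, y', hx, hxy⟩ := h (L.iCycles j w) (by simp [← ConcreteCategory.comp_apply])
    obtain ⟨z, rfl⟩ := K.exists_iCycles_eq hk hx
    refine ⟨K.homologyπ j z, ?_⟩
    rw [map_homologyπ, eq_comm, ← sub_eq_zero, ← map_sub, L.homologyπ_eq_zero_iff hi]
    exact ⟨y', by rw [map_sub, iCycles_cyclesMap, hxy, add_sub_cancel_left]⟩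

/-- A morphism of complexes of modules is a quasi-isomorphism iff its mapping cone is acyclic,
expressed in terms of elements. -/
theorem quasiIso_iff_forall_exists (hnext : ∀ i, ∃ j, c.Rel i j) (hprev : ∀ j, ∃ i, c.Rel i j) :
    QuasiIso f ↔ ∀ (h i j k : ι), c.Rel h i → c.Rel i j → c.Rel j k →
      ∀ (x : K.X j) (y : L.X i), K.d j k x = 0 → f.f j x = L.d i j y →
        ∃ (x' : K.X i) (y' : L.X h), x = K.d i j x' ∧ y = f.f i x' + L.d h i y' := by
  simp only [quasiIso_iff, quasiIsoAt_iff_isIso_homologyMap, ConcreteCategory.isIso_iff_bijective]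
  constructor
  · intro H h i j k hhi hij hjk x y hx hxy
    obtain ⟨x', rfl⟩ :=
      (injective_homologyMap_iff f (c.prev_eq' hij) (c.next_eq' hjk)).1 (H j).1 x y hx hxy
    obtain ⟨x'', y', hx'', hy⟩ :=
      (surjective_homologyMap_iff f (c.prev_eq' hhi) (c.next_eq' hij)).1 (H i).2
        (y - f.f i x') (by
          rw [map_sub, ← hxy, ← ConcreteCategory.comp_apply, ← ConcreteCategory.comp_apply,
            f.comm, sub_self])
    refine ⟨x' + x'', y', by rw [map_add, hx'', add_zero], ?_⟩
    rw [map_add, add_assoc, ← hy, add_sub_cancel]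
  · intro H i
    obtain ⟨j, hij⟩ := hnext i
    obtain ⟨k, hjk⟩ := hnext j
    obtain ⟨h, hhi⟩ := hprev i
    obtain ⟨g, hgh⟩ := hprev h
    constructor
    · refine (injective_homologyMap_iff f (c.prev_eq' hhi) (c.next_eq' hij)).2 fun x y hx hxy => ?_
      obtain ⟨x', -, hx', -⟩ := H g h i j hgh hhi hij x y hx hxy
      exact ⟨x', hx'⟩
    · refine (surjective_homologyMap_iff f (c.prev_eq' hhi) (c.next_eq' hij)).2 fun y hy => ?_
      obtain ⟨x', y', hx', hy'⟩ := H h i j k hhi hij hjk 0 y (map_zero _) (by rw [hy, map_zero])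
      exact ⟨x', y', hx'.symm, hy'⟩

end HomologicalComplex

namespace ModuleCat.ExtendScalars

variable {R : Type u} {S : Type} [CommRing R] [CommRing S] {f : R →+* S} {I : Ideal R}

/-- The map `S ⊗ M → M / I M` induced by an `R`-linear map `S → R / I`. -/
noncomputable def toQuotient (φ : (restrictScalars f).obj (of S S) →ₗ[R] R ⧸ I)
    (M : ModuleCat.{v} R) : (extendScalars f).obj M →+ M ⧸ (I • ⊤ : Submodule R M) :=
  ((TensorProduct.quotTensorEquivQuotSMul M I).toLinearMap ∘ₗ φ.rTensor M).toAddMonoidHom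

variable (φ : (restrictScalars f).obj (of S S) →ₗ[R] R ⧸ I)

open scoped ChangeOfRings in
theorem toQuotient_one_tmul (hφ : φ (1 : S) = 1) {M : ModuleCat.{v} R} (m : M) :
    toQuotient φ M ((1 : S) ⊗ₜ[R, f] m) = Submodule.Quotient.mk m := by
  refine Eq.trans ?_ (TensorProduct.quotTensorEquivQuotSMul_mk_one_tmul (M := M) I m)
  rw [← hφ]
  rfl

theorem exists_toQuotient_map_eq {M : ModuleCat.{v} R} (t : (extendScalars f).obj M) :
    ∃ m : M, ∀ (N : ModuleCat.{v} R) (g : M ⟶ N),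
      toQuotient φ N ((extendScalars f).map g t) = Submodule.Quotient.mk (g m) := by
  induction t using TensorProduct.induction_on with
  | zero => exact ⟨0, fun N g => by
      rw [map_zero, Submodule.Quotient.mk_zero]
      exact map_zero (toQuotient φ N)⟩
  | tmul s m =>
    obtain ⟨r, hr⟩ := Ideal.Quotient.mk_surjective (φ s)
    refine ⟨r • m, fun N g => ?_⟩
    rw [map_smul]
    refine Eq.trans ?_ (TensorProduct.quotTensorEquivQuotSMul_mk_tmul (M := N) I r (g m))
    rw [hr]
    rfl
  | add t t' ht ht' =>
    obtain ⟨m, hm⟩ := ht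
    obtain ⟨m', hm'⟩ := ht'
    refine ⟨m + m', fun N g => ?_⟩
    rw [map_add g.hom, Submodule.Quotient.mk_add, ← hm, ← hm', ← map_add]
    exact congrArg _ (map_add ((extendScalars f).map g).hom t t')

end ModuleCat.ExtendScalars

open ModuleCat.ExtendScalars ChangeOfRings in
/-- If `f` becomes a quasi-isomorphism after extension of scalars to `S`, and there is a linear map
`S → R / I` sending `1` to `1`, then cycles of the mapping cone of `f` are boundaries modulo `I`. -/
theorem HomologicalComplex.exists_sub_mem_of_quasiIso_extendScalars
    {R : Type u} {S : Type} [CommRing R] [CommRing S] {g : R →+* S} {I : Ideal R}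
    (φ : (ModuleCat.restrictScalars g).obj (ModuleCat.of S S) →ₗ[R] R ⧸ I) (hφ : φ (1 : S) = 1)
    {ι : Type*} {c : ComplexShape ι} (hnext : ∀ i, ∃ j, c.Rel i j) (hprev : ∀ j, ∃ i, c.Rel i j)
    {K L : HomologicalComplex (ModuleCat.{v} R) c} (f : K ⟶ L)
    (hf : QuasiIso (((ModuleCat.extendScalars g).mapHomologicalComplex c).map f))
    {h i j k : ι} (hhi : c.Rel h i) (hij : c.Rel i j) (hjk : c.Rel j k)
    (x : K.X j) (y : L.X i) (hx : K.d j k x = 0) (hxy : f.f j x = L.d i j y) :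
    ∃ (x' : K.X i) (y' : L.X h), x - K.d i j x' ∈ (I • ⊤ : Submodule R (K.X j)) ∧
      y - (f.f i x' + L.d h i y') ∈ (I • ⊤ : Submodule R (L.X i)) := by
  obtain ⟨s, t, hs, ht⟩ := (quasiIso_iff_forall_exists _ hnext hprev).1 hf h i j k hhi hij hjk
    ((1 : S) ⊗ₜ[R, g] x) ((1 : S) ⊗ₜ[R, g] y)
    ((map_tmul g (K.d j k) 1 x).trans (by
      rw [hx]
      let := g.toAlgebra
      exact TensorProduct.tmul_zero (R := R) (M := S) (K.X k) 1))
    ((map_tmul g (f.f j) 1 x).trans (by rw [hxy]; rfl))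
  obtain ⟨x', hx'⟩ := exists_toQuotient_map_eq φ s
  obtain ⟨y', hy'⟩ := exists_toQuotient_map_eq φ t
  refine ⟨x', y', (Submodule.Quotient.eq _).1 ?_, (Submodule.Quotient.eq _).1 ?_⟩
  · rw [← toQuotient_one_tmul φ hφ, ← hx']
    exact congrArg _ hs
  · rw [← toQuotient_one_tmul φ hφ, Submodule.Quotient.mk_add, ← hx', ← hy', ← map_add]
    exact congrArg _ ht

/-- There is an additive map `𝔽̄ₚ → ℤ / p` which sends `1` to `1`. -/
theorem exists_linearMap_algebraicClosure_zmod (p : ℕ) [Fact p.Prime] :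
    ∃ φ : (ModuleCat.restrictScalars (Int.castRingHom (AlgebraicClosure (ZMod p)))).obj
        (ModuleCat.of _ (AlgebraicClosure (ZMod p))) →ₗ[ℤ] ℤ ⧸ Ideal.span {(p : ℤ)},
      φ (1 : AlgebraicClosure (ZMod p)) = 1 := by
  obtain ⟨ψ, hψ⟩ := LinearMap.exists_leftInverse_of_injective
    (Algebra.linearMap (ZMod p) (AlgebraicClosure (ZMod p)))
    (LinearMap.ker_eq_bot.2 (algebraMap (ZMod p) (AlgebraicClosure (ZMod p))).injective)
  have h1 : ψ 1 = 1 := by simpa using LinearMap.congr_fun hψ 1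
  refine ⟨{ toFun := fun a => (Int.quotientSpanNatEquivZMod p).symm (ψ a)
            map_add' := fun a b => ?_
            map_smul' := fun n a => ?_ }, ?_⟩
  · exact (congrArg _ (map_add ψ a b)).trans (map_add _ _ _)
  · exact map_intCast_smul
      ((Int.quotientSpanNatEquivZMod p).symm.toAddMonoidHom.comp ψ.toAddMonoidHom) ℤ ℤ n a
  · exact (congrArg _ h1).trans (map_one (Int.quotientSpanNatEquivZMod p).symm)

/-- Exactness of a sequence of modules over a principal ideal domain can be checked modulo all
maximal ideals. -/
theorem LinearMap.ker_le_range_of_forall_isMaximal {R A B C : Type*} [CommRing R] [IsDomain R]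
    [IsPrincipalIdealRing R] (hR : ¬IsField R) [AddCommGroup A] [AddCommGroup B] [AddCommGroup C]
    [Module R A] [Module R B] [Module R C] [Module.Finite R B] [Module.IsTorsionFree R C]
    (α : A →ₗ[R] B) (β : B →ₗ[R] C) (hβα : ∀ a, β (α a) = 0)
    (H : ∀ I : Ideal R, I.IsMaximal → ∀ b ∈ ker β, ∃ a, b - α a ∈ (I • ⊤ : Submodule R B)) :
    ker β ≤ range α := by
  refine (IsNoetherian.noetherian (ker β)).le_of_forall_isMaximal_le_sup_smul fun I hI b hb => ?_
  obtain ⟨a, ha⟩ := H I hI b hb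
  obtain ⟨r, rfl⟩ := (IsPrincipalIdealRing.principal I).principal
  have hr : r ≠ 0 := by
    rintro rfl
    exact Ring.ne_bot_of_isMaximal_of_not_isField hI hR (by simp)
  rw [← Ideal.span, Submodule.ideal_span_singleton_smul] at ha ⊢
  obtain ⟨b', -, hb'⟩ := (Submodule.mem_smul_pointwise_iff_exists _ _ _).1 ha
  have hker : b' ∈ ker β := by
    have : r • β b' = 0 := by
      rw [← map_smul, hb', map_sub, hβα, mem_ker.1 hb, sub_zero]
    exact (smul_eq_zero.1 this).resolve_left hr
  rw [← add_sub_cancel (α a) b, ← hb']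
  exact Submodule.add_mem_sup (mem_range_self α a) (Submodule.smul_mem_pointwise_smul _ _ _ hker)

/-- A morphism of complexes of finite torsion-free modules over a principal ideal domain is a
quasi-isomorphism if, for every maximal ideal `I`, it becomes one after extension of scalars to
some `S` which maps linearly to `R / I`, preserving `1`. -/
theorem HomologicalComplex.quasiIso_of_forall_isMaximal_extendScalars
    {R : Type u} [CommRing R] [IsDomain R] [IsPrincipalIdealRing R] (hR : ¬IsField R)
    {ι : Type*} {c : ComplexShape ι} (hnext : ∀ i, ∃ j, c.Rel i j) (hprev : ∀ j, ∃ i, c.Rel i j)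
    {K L : HomologicalComplex (ModuleCat.{v} R) c}
    [∀ i, Module.Finite R (K.X i)] [∀ i, Module.Finite R (L.X i)]
    [∀ i, Module.IsTorsionFree R (K.X i)] [∀ i, Module.IsTorsionFree R (L.X i)] (f : K ⟶ L)
    (H : ∀ I : Ideal R, I.IsMaximal → ∃ (S : Type) (_ : CommRing S) (g : R →+* S)
      (φ : (ModuleCat.restrictScalars g).obj (ModuleCat.of S S) →ₗ[R] R ⧸ I),
      φ (1 : S) = 1 ∧ QuasiIso (((ModuleCat.extendScalars g).mapHomologicalComplex c).map f)) :
    QuasiIso f := by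
  rw [quasiIso_iff_forall_exists f hnext hprev]
  intro h i j k hhi hij hjk x y hx hxy
  let α : K.X i × L.X h →ₗ[R] K.X j × L.X i :=
    .prod ((K.d i j).hom ∘ₗ .fst _ _ _) (.coprod (f.f i).hom (L.d h i).hom)
  let β : K.X j × L.X i →ₗ[R] K.X k × L.X j :=
    .prod ((K.d j k).hom ∘ₗ .fst _ _ _) (.coprod (f.f j).hom (-(L.d i j).hom))
  have hβα (a) : β (α a) = 0 := by
    have hC : K.d j k (K.d i j a.1) = 0 := by
      rw [← ConcreteCategory.comp_apply, K.d_comp_d]; rfl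
    have hD : L.d i j (L.d h i a.2) = 0 := by
      rw [← ConcreteCategory.comp_apply, L.d_comp_d]; rfl
    have hf : L.d i j (f.f i a.1) = f.f j (K.d i j a.1) := by
      rw [← ConcreteCategory.comp_apply, ← ConcreteCategory.comp_apply, f.comm]
    refine Prod.ext hC ?_
    change f.f j (K.d i j a.1) + -L.d i j (f.f i a.1 + L.d h i a.2) = 0
    rw [map_add, hf, hD, add_zero, add_neg_cancel]
  have hker : (x, y) ∈ LinearMap.ker β := by
    refine Prod.ext hx ?_
    change f.f j x + -L.d i j y = 0
    rw [hxy, add_neg_cancel]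
  obtain ⟨⟨x', y'⟩, hxy'⟩ := LinearMap.ker_le_range_of_forall_isMaximal
      hR α β hβα (fun I hI b hb => by
    obtain ⟨S, _, g, φ, hφ, hg⟩ := H I hI
    obtain ⟨x', y', hx', hy'⟩ := exists_sub_mem_of_quasiIso_extendScalars
      φ hφ hnext hprev f hg hhi hij hjk b.1 b.2 (congrArg Prod.fst hb)
      (eq_of_sub_eq_zero ((sub_eq_add_neg _ _).trans (congrArg Prod.snd hb)))
    obtain ⟨r, rfl⟩ := (IsPrincipalIdealRing.principal I).principal
    rw [← Ideal.span, Submodule.ideal_span_singleton_smul,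
      Submodule.mem_smul_pointwise_iff_exists] at hx' hy'
    obtain ⟨u, -, hu⟩ := hx'
    obtain ⟨v, -, hv⟩ := hy'
    refine ⟨(x', y'), ?_⟩
    rw [← Ideal.span, Submodule.ideal_span_singleton_smul,
      Submodule.mem_smul_pointwise_iff_exists]
    exact ⟨(u, v), trivial, Prod.ext hu hv⟩) hker
  exact ⟨x', y', (congrArg Prod.fst hxy').symm, (congrArg Prod.snd hxy').symm⟩

/-- Let `f : C → D` be a morphism of bounded chain complexes of finitely
generated free `ℤ`-modules. If `f ⊗ 𝔽̄ₚ` is a quasi-isomorphism for every prime `p`, and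
`f ⊗ ℚ̄` is a quasi-isomorphism, then `f` is a quasi-isomorphism. -/
theorem quasiIso_of_quasiIso_base_change_algClosures
    (C D : ChainComplex (ModuleCat ℤ) ℤ)
    (hCbdd : ∃ a b : ℤ, ∀ n : ℤ, (n < a ∨ b < n) → Limits.IsZero (C.X n))
    (hDbdd : ∃ a b : ℤ, ∀ n : ℤ, (n < a ∨ b < n) → Limits.IsZero (D.X n))
    (hCfree : ∀ n : ℤ, Module.Free ℤ (C.X n)) (hCfin : ∀ n : ℤ, Module.Finite ℤ (C.X n))
    (hDfree : ∀ n : ℤ, Module.Free ℤ (D.X n)) (hDfin : ∀ n : ℤ, Module.Finite ℤ (D.X n))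
    (f : C ⟶ D)
    (hp : ∀ (p : ℕ) [Fact p.Prime],
      QuasiIso (((ModuleCat.extendScalars
        (Int.castRingHom (AlgebraicClosure (ZMod p)))).mapHomologicalComplex
          (ComplexShape.down ℤ)).map f))
    (hq : QuasiIso (((ModuleCat.extendScalars
        (Int.castRingHom (AlgebraicClosure ℚ))).mapHomologicalComplex
          (ComplexShape.down ℤ)).map f)) :
    QuasiIso f := by
  have hnext (i : ℤ) : ∃ j, (ComplexShape.down ℤ).Rel i j := ⟨i - 1, by simp⟩
  have hprev (j : ℤ) : ∃ i, (ComplexShape.down ℤ).Rel i j := ⟨j + 1, by simp⟩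
  refine HomologicalComplex.quasiIso_of_forall_isMaximal_extendScalars Int.not_isField hnext hprev f
    fun I hI => ?_
  obtain ⟨p, hpp, rfl⟩ := Int.exists_prime_eq_span_of_isMaximal hI
  have : Fact p.Prime := ⟨hpp⟩
  obtain ⟨φ, hφ⟩ := exists_linearMap_algebraicClosure_zmod p
  exact ⟨_, _, _, φ, hφ, hp p⟩
end

section
/- Let f : C → D be a morphism of bounded chain complexes of finitely generated free ℤ-modules such that f ⊗ K is a quasi-isomorphism for every algebraically closed field K. Then f induces an isomorphism on integral homology. -/
open CategoryTheory

namespace HomologicalComplex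

variable {R : Type*} [Ring R] {ι : Type*} {c : ComplexShape ι}
  {K L : HomologicalComplex (ModuleCat R) c} (φ : K ⟶ L)

/-- Injectivity on homology of a morphism of complexes of modules, in terms of elements. -/
lemma mono_homologyMap_iff_moduleCat (i j k : ι) (hi : c.prev j = i) (hk : c.next j = k) :
    Mono (homologyMap φ j) ↔
      ∀ (x : K.X j) (y : L.X i), K.d j k x = 0 → φ.f j x = L.d i j y →
        ∃ x' : K.X i, K.d i j x' = x := by
  rw [mono_homologyMap_iff_up_to_refinements φ i j k hi hk]
  constructor
  · intro h x y hx hxy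
    let S : Submodule R (K.X j × L.X i) :=
      LinearMap.ker ((K.d j k).hom.comp (LinearMap.fst R _ _)) ⊓
        LinearMap.eqLocus ((φ.f j).hom.comp (LinearMap.fst R _ _))
          ((L.d i j).hom.comp (LinearMap.snd R _ _))
    obtain ⟨A, π, hπ, x₁, h₁⟩ := h (A := ModuleCat.of R S)
      (ModuleCat.ofHom ((LinearMap.fst R _ _).comp S.subtype)) (by ext s; exact s.2.1)
      (ModuleCat.ofHom ((LinearMap.snd R _ _).comp S.subtype)) (by ext s; exact s.2.2)
    obtain ⟨a, ha⟩ := (ModuleCat.epi_iff_surjective π).1 hπ ⟨(x, y), hx, hxy⟩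
    exact ⟨x₁ a, by simpa [ha] using (ConcreteCategory.congr_hom h₁ a).symm⟩
  · intro h A x hx y hxy
    let S : Submodule R (A × K.X i) :=
      LinearMap.eqLocus (x.hom.comp (LinearMap.fst R _ _))
        ((K.d i j).hom.comp (LinearMap.snd R _ _))
    refine ⟨ModuleCat.of R S, ModuleCat.ofHom ((LinearMap.fst R _ _).comp S.subtype), ?_,
      ModuleCat.ofHom ((LinearMap.snd R _ _).comp S.subtype), by ext s; exact s.2⟩
    rw [ModuleCat.epi_iff_surjective]
    intro a
    obtain ⟨x', hx'⟩ := h (x a) (y a) (ConcreteCategory.congr_hom hx a)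
      (ConcreteCategory.congr_hom hxy a)
    exact ⟨⟨(a, x'), hx'.symm⟩, rfl⟩

/-- Surjectivity on homology of a morphism of complexes of modules, in terms of elements. -/
lemma epi_homologyMap_iff_moduleCat (i j k : ι) (hi : c.prev j = i) (hk : c.next j = k) :
    Epi (homologyMap φ j) ↔
      ∀ y : L.X j, L.d j k y = 0 →
        ∃ (x : K.X j) (y' : L.X i), K.d j k x = 0 ∧ φ.f j x + L.d i j y' = y := by
  rw [epi_homologyMap_iff_up_to_refinements φ i j k hi hk]
  constructor
  · intro h y hy
    let S : Submodule R (L.X j) := LinearMap.ker (L.d j k).hom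
    obtain ⟨A, π, hπ, x₂, hx₂, y₁, h₁⟩ := h (A := ModuleCat.of R S)
      (ModuleCat.ofHom S.subtype) (by ext s; exact s.2)
    obtain ⟨a, ha⟩ := (ModuleCat.epi_iff_surjective π).1 hπ ⟨y, hy⟩
    exact ⟨x₂ a, y₁ a, ConcreteCategory.congr_hom hx₂ a,
      by simpa [ha] using (ConcreteCategory.congr_hom h₁ a).symm⟩
  · intro h A y hy
    let S : Submodule R (A × K.X j × L.X i) :=
      LinearMap.ker (((K.d j k).hom.comp (LinearMap.fst R _ _)).comp (LinearMap.snd R _ _)) ⊓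
        LinearMap.eqLocus (y.hom.comp (LinearMap.fst R _ _))
          (((φ.f j).hom.coprod (L.d i j).hom).comp (LinearMap.snd R _ _))
    refine ⟨ModuleCat.of R S, ModuleCat.ofHom ((LinearMap.fst R _ _).comp S.subtype), ?_,
      ModuleCat.ofHom (((LinearMap.fst R _ _).comp (LinearMap.snd R _ _)).comp S.subtype),
      by ext s; exact s.2.1,
      ModuleCat.ofHom (((LinearMap.snd R _ _).comp (LinearMap.snd R _ _)).comp S.subtype),
      by ext s; exact s.2.2⟩
    rw [ModuleCat.epi_iff_surjective]
    intro a
    obtain ⟨x, y', hx, hxy⟩ := h (y a) (ConcreteCategory.congr_hom hy a)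
    exact ⟨⟨(a, x, y'), hx, hxy.symm⟩, rfl⟩

end HomologicalComplex

/-- A finitely generated module `M` with `𝔪 M = M` for all maximal ideals `𝔪` vanishes. -/
lemma Module.subsingleton_of_forall_isMaximal_smul_top_eq_top {R M : Type*} [CommRing R]
    [AddCommGroup M] [Module R M] [Module.Finite R M]
    (h : ∀ m : Ideal R, m.IsMaximal → m • (⊤ : Submodule R M) = ⊤) : Subsingleton M := by
  rw [← Module.annihilator_eq_top_iff (R := R)]
  by_contra hne
  obtain ⟨m, hm, hle⟩ := Ideal.exists_le_maximal _ hne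
  obtain ⟨r, hr, hr'⟩ := Submodule.exists_sub_one_mem_and_smul_eq_zero_of_fg_of_le_smul m ⊤
    Module.Finite.fg_top (h m hm).ge
  have hrm : r ∈ m := hle (Module.mem_annihilator.2 fun x ↦ hr' x trivial)
  exact hm.ne_top ((Ideal.eq_top_iff_one m).2 (by simpa using m.sub_mem hrm hr))

/-- Submodules `N` and `P` of a noetherian module satisfy `N ≤ P` if this holds modulo `𝔪 N`
for all maximal ideals `𝔪`. -/
lemma Submodule.le_of_forall_isMaximal_exists_sub_smul_mem {R E : Type*} [CommRing R]
    [AddCommGroup E] [Module R E] [IsNoetherian R E] {N P : Submodule R E}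
    (h : ∀ m : Ideal R, m.IsMaximal → ∀ z ∈ N, ∃ r ∈ m, ∃ e ∈ N, z - r • e ∈ P) : N ≤ P := by
  have : Subsingleton (N ⧸ P.submoduleOf N) := by
    refine Module.subsingleton_of_forall_isMaximal_smul_top_eq_top (R := R) fun m hm ↦ ?_
    rw [eq_top_iff]
    rintro x -
    obtain ⟨⟨z, hz⟩, rfl⟩ := Submodule.Quotient.mk_surjective _ x
    obtain ⟨r, hr, e, he, hze⟩ := h m hm z hz
    have : (Submodule.Quotient.mk ⟨z, hz⟩ : N ⧸ P.submoduleOf N) =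
        r • Submodule.Quotient.mk ⟨e, he⟩ := by
      rw [← Submodule.Quotient.mk_smul, Submodule.Quotient.eq]
      exact hze
    rw [this]
    exact Submodule.smul_mem_smul hr trivial
  rwa [Submodule.Quotient.subsingleton_iff, Submodule.submoduleOf_eq_top] at this

/-- Elements outside `P + p E` are detected by semilinear maps from `E / P` to a field `K`
receiving a ring homomorphism whose kernel is maximal and generated by `p`. -/
lemma Submodule.exists_sub_smul_mem_of_forall_semilinearMap {R E K : Type*} [CommRing R]
    [AddCommGroup E] [Module R E] [Field K] (φ : R →+* K) [hφ : (RingHom.ker φ).IsMaximal]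
    {p : R} (hp : RingHom.ker φ = Ideal.span {p}) (P : Submodule R E) (z : E)
    (h : ∀ g : E →ₛₗ[φ] K, (∀ x ∈ P, g x = 0) → g z = 0) :
    ∃ e : E, z - p • e ∈ P := by
  let m := RingHom.ker φ
  let : Field (R ⧸ m) := Ideal.Quotient.field m
  let q : E →ₗ[R] (E ⧸ P) ⧸ (m • ⊤ : Submodule R (E ⧸ P)) := (Submodule.mkQ _).comp P.mkQ
  have hz : q z = 0 := by
    refine (Module.forall_dual_apply_eq_zero_iff (R := R ⧸ m) _).1 fun ψ ↦ ?_
    refine (RingHom.kerLift_injective φ) ?_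
    rw [map_zero]
    let g : E →ₛₗ[φ] K :=
      { toFun x := RingHom.kerLift φ (ψ (q x))
        map_add' x y := by simp
        map_smul' r x := by
          have : q (r • x) = Ideal.Quotient.mk m r • q x := by rw [map_smul]; rfl
          rw [this, map_smul, smul_eq_mul, map_mul]
          rfl }
    refine h g fun x hx ↦ ?_
    have : q x = 0 := by simp [q, (Submodule.Quotient.mk_eq_zero P).2 hx]
    simp [g, this]
  have hz' := (Submodule.Quotient.mk_eq_zero _).1 hz
  rw [show m = Ideal.span {p} from hp, Submodule.ideal_span_singleton_smul,
    Submodule.mem_smul_pointwise_iff_exists] at hz'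
  obtain ⟨x, -, hx⟩ := hz'
  obtain ⟨e, rfl⟩ := Submodule.Quotient.mk_surjective _ x
  exact ⟨e, (Submodule.Quotient.eq P).1 hx.symm⟩

namespace ModuleCat

variable {R K : Type*} [CommRing R] [CommRing K] {φ : R →+* K} {M N : ModuleCat R}

open ChangeOfRings in
variable (φ M) in
/-- The map `m ↦ k ⊗ m` from `M` to `K ⊗ M`. -/
noncomputable def extendScalarsTmul (k : K) : M →+ (extendScalars φ).obj M where
  toFun m := k ⊗ₜ[R, φ] m
  map_zero' :=
    let : Module R K := Module.compHom K φ
    TensorProduct.tmul_zero M k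
  map_add' m m' :=
    let : Module R K := Module.compHom K φ
    TensorProduct.tmul_add k m m'

lemma extendScalars_map_tmul (g : M ⟶ N) (k : K) (m : M) :
    (extendScalars φ).map g (extendScalarsTmul φ M k m) = extendScalarsTmul φ N k (g m) :=
  rfl

@[elab_as_elim]
lemma extendScalars_induction {motive : (extendScalars φ).obj M → Prop}
    (t : (extendScalars φ).obj M)
    (zero : motive 0) (tmul : ∀ (k : K) (m : M), motive (extendScalarsTmul φ M k m))
    (add : ∀ s t, motive s → motive t → motive (s + t)) : motive t :=
  TensorProduct.induction_on t zero tmul add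

/-- Semilinear maps from `M` to `K` extend along `M → K ⊗ M`. -/
lemma exists_extendScalars_addMonoidHom (g : M →ₛₗ[φ] K) :
    ∃ G : (extendScalars φ).obj M →+ K,
      ∀ (k : K) (m : M), G (extendScalarsTmul φ M k m) = k * g m := by
  let : Module R K := Module.compHom K φ
  have h (r : R) (k : K) (m : M) : (r • k) * g m = k * g (r • m) := by
    have : r • k = φ r * k := rfl
    rw [this, LinearMap.map_smulₛₗ, smul_eq_mul]
    ring
  let b : K →+ M →+ K := (AddMonoidHom.compHom' g.toAddMonoidHom).comp AddMonoidHom.mul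
  let G : TensorProduct R K M →+ K := TensorProduct.liftAddHom b h
  exact ⟨G, fun k m ↦ rfl⟩

end ModuleCat

namespace ChainComplex

section

variable {R : Type*} [Ring R] {C D : ChainComplex (ModuleCat R) ℤ} (f : C ⟶ D) (n : ℤ)

/-- The boundaries of the mapping cone of `f` in degree `n + 1`, up to signs. -/
def coneBoundaries : Submodule R (C.X n × D.X (n + 1)) :=
  LinearMap.range (((C.d (n + 1) n).hom.prod (f.f (n + 1)).hom).coprod
    ((0 : D.X (n + 1 + 1) →ₗ[R] C.X n).prod (D.d (n + 1 + 1) (n + 1)).hom))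

/-- The cycles of the mapping cone of `f` in degree `n + 1`, up to signs. -/
def coneCycles : Submodule R (C.X n × D.X (n + 1)) :=
  LinearMap.ker ((C.d n (n - 1)).hom.comp (LinearMap.fst R (C.X n) (D.X (n + 1)))) ⊓
    LinearMap.eqLocus ((f.f n).hom.comp (LinearMap.fst R _ _))
      ((D.d (n + 1) n).hom.comp (LinearMap.snd R _ _))

lemma mem_coneBoundaries {z : C.X n × D.X (n + 1)} :
    z ∈ coneBoundaries f n ↔ ∃ (x' : C.X (n + 1)) (y' : D.X (n + 1 + 1)),
      C.d (n + 1) n x' = z.1 ∧ f.f (n + 1) x' + D.d (n + 1 + 1) (n + 1) y' = z.2 := by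
  simp [coneBoundaries, Prod.ext_iff]

lemma mem_coneCycles {z : C.X n × D.X (n + 1)} :
    z ∈ coneCycles f n ↔ C.d n (n - 1) z.1 = 0 ∧ f.f n z.1 = D.d (n + 1) n z.2 :=
  Iff.rfl

lemma f_d_apply (i j : ℤ) (x : C.X i) : f.f j (C.d i j x) = D.d i j (f.f i x) :=
  (ConcreteCategory.congr_hom (f.comm i j) x).symm

lemma coneBoundaries_le_coneCycles : coneBoundaries f n ≤ coneCycles f n := by
  intro z hz
  obtain ⟨x', y', hx, hy⟩ := (mem_coneBoundaries f n).1 hz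
  rw [mem_coneCycles, ← hx, ← hy, map_add, f_d_apply]
  have h₁ := ConcreteCategory.congr_hom (C.d_comp_d (n + 1) n (n - 1)) x'
  have h₂ := ConcreteCategory.congr_hom (D.d_comp_d (n + 1 + 1) (n + 1) n) y'
  rw [ModuleCat.comp_apply] at h₁ h₂
  exact ⟨h₁, by rw [h₂]; simp⟩

/-- A morphism of chain complexes of modules is a quasi-isomorphism if and only if its mapping
cone is exact. -/
lemma quasiIso_iff_coneCycles_le_coneBoundaries :
    QuasiIso f ↔ ∀ n, coneCycles f n ≤ coneBoundaries f n := by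
  simp only [quasiIso_iff, quasiIsoAt_iff_isIso_homologyMap]
  constructor
  · rintro h n ⟨x, y⟩ ⟨hx, hxy : f.f n x = D.d (n + 1) n y⟩
    obtain ⟨x₁, rfl⟩ := (HomologicalComplex.mono_homologyMap_iff_moduleCat f (n + 1) n (n - 1)
      (by simp) (by simp)).1 inferInstance x y hx hxy
    obtain ⟨x₂, y', hx₂, hy'⟩ := (HomologicalComplex.epi_homologyMap_iff_moduleCat f (n + 1 + 1)
      (n + 1) n (by simp) (by simp)).1 inferInstance (y - f.f (n + 1) x₁)
      (by rw [map_sub, ← hxy, f_d_apply, sub_self])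
    refine (mem_coneBoundaries f n).2 ⟨x₁ + x₂, y', by simp [hx₂], ?_⟩
    rw [map_add, add_assoc, hy']
    abel
  · intro h n
    have : Mono (HomologicalComplex.homologyMap f n) := by
      rw [HomologicalComplex.mono_homologyMap_iff_moduleCat f (n + 1) n (n - 1)
        (by simp) (by simp)]
      intro x y hx hxy
      obtain ⟨x', -, hx', -⟩ := (mem_coneBoundaries f n).1
        (h n ((mem_coneCycles f n (z := (x, y))).2 ⟨hx, hxy⟩))
      exact ⟨x', hx'⟩
    have : Epi (HomologicalComplex.homologyMap f n) := by
      obtain ⟨m, rfl⟩ : ∃ m, n = m + 1 := ⟨n - 1, by simp⟩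
      rw [HomologicalComplex.epi_homologyMap_iff_moduleCat f (m + 1 + 1) (m + 1) m
        (by simp) (by simp)]
      intro y hy
      exact (mem_coneBoundaries f m).1 (h m ((mem_coneCycles f m (z := (0, y))).2
        ⟨map_zero _, by rw [map_zero, hy]⟩))
    exact isIso_of_mono_of_epi _

end

variable {R : Type*} [CommRing R] {C D : ChainComplex (ModuleCat R) ℤ} (f : C ⟶ D) (n : ℤ)

/-- If `f ⊗ K` is a quasi-isomorphism, then every semilinear map to `K` vanishing on the
boundaries of the mapping cone of `f` vanishes on its cycles. -/
lemma semilinearMap_apply_eq_zero_of_quasiIso_extendScalars {K : Type*} [CommRing K] (φ : R →+* K)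
    (h : QuasiIso (((ModuleCat.extendScalars φ).mapHomologicalComplex
      (ComplexShape.down ℤ)).map f))
    (g : (C.X n × D.X (n + 1)) →ₛₗ[φ] K) (hg : ∀ x ∈ coneBoundaries f n, g x = 0)
    {z : C.X n × D.X (n + 1)} (hz : z ∈ coneCycles f n) : g z = 0 := by
  obtain ⟨h₁, h₂⟩ := (mem_coneCycles f n).1 hz
  obtain ⟨A, hA⟩ := ModuleCat.exists_extendScalars_addMonoidHom
    (g.comp (LinearMap.inl R (C.X n) (D.X (n + 1))))
  obtain ⟨B, hB⟩ := ModuleCat.exists_extendScalars_addMonoidHom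
    (g.comp (LinearMap.inr R (C.X n) (D.X (n + 1))))
  let F := ModuleCat.extendScalars φ
  have hAB (t : F.obj (C.X (n + 1))) :
      A (F.map (C.d (n + 1) n) t) + B (F.map (f.f (n + 1)) t) = 0 := by
    induction t using ModuleCat.extendScalars_induction with
    | zero => simp
    | add s t hs ht => rw [map_add, map_add, map_add, map_add, add_add_add_comm, hs, ht, add_zero]
    | tmul k x' =>
      have := hg _ ((mem_coneBoundaries f n (z := (C.d (n + 1) n x', f.f (n + 1) x'))).2
        ⟨x', 0, rfl, by simp⟩)
      rw [ModuleCat.extendScalars_map_tmul, ModuleCat.extendScalars_map_tmul, hA, hB, ← mul_add,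
        LinearMap.comp_apply, LinearMap.comp_apply, ← map_add]
      simp [this]
  have hB' (t : F.obj (D.X (n + 1 + 1))) : B (F.map (D.d (n + 1 + 1) (n + 1)) t) = 0 := by
    induction t using ModuleCat.extendScalars_induction with
    | zero => simp
    | add s t hs ht => rw [map_add, map_add, hs, ht, add_zero]
    | tmul k y' =>
      have := hg _ ((mem_coneBoundaries f n (z := (0, D.d (n + 1 + 1) (n + 1) y'))).2
        ⟨0, y', by simp, by simp⟩)
      rw [ModuleCat.extendScalars_map_tmul, hB]
      simp [this]
  let c := ModuleCat.extendScalarsTmul φ (C.X n) 1 z.1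
  let d := ModuleCat.extendScalarsTmul φ (D.X (n + 1)) 1 z.2
  have hc : F.map (C.d n (n - 1)) c = 0 := by
    rw [ModuleCat.extendScalars_map_tmul, h₁, map_zero]
  have hcd : F.map (f.f n) c = F.map (D.d (n + 1) n) d := by
    rw [ModuleCat.extendScalars_map_tmul, ModuleCat.extendScalars_map_tmul, h₂]
  let f' := (F.mapHomologicalComplex (ComplexShape.down ℤ)).map f
  have hz' : (c, d) ∈ coneCycles f' n := (mem_coneCycles f' n).2 ⟨hc, hcd⟩
  obtain ⟨x', y', hx', hy'⟩ : ∃ (x' : F.obj (C.X (n + 1))) (y' : F.obj (D.X (n + 1 + 1))),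
      F.map (C.d (n + 1) n) x' = c ∧
        F.map (f.f (n + 1)) x' + F.map (D.d (n + 1 + 1) (n + 1)) y' = d :=
    (mem_coneBoundaries f' n).1 ((quasiIso_iff_coneCycles_le_coneBoundaries f').1 h n hz')
  calc g z = A c + B d := by
        rw [hA, hB, one_mul, one_mul, LinearMap.comp_apply, LinearMap.comp_apply, ← map_add]
        simp
    _ = 0 := by rw [← hx', ← hy', map_add, hB', add_zero, hAB]

/-- A morphism of complexes of finitely generated free modules over a principal ideal domain is a
quasi-isomorphism if it is so after base change to some field over each residue field. -/
lemma quasiIso_of_quasiIso_extendScalars [IsDomain R] [IsPrincipalIdealRing R]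
    [∀ n, Module.Free R (C.X n)] [∀ n, Module.Finite R (C.X n)]
    [∀ n, Module.Free R (D.X n)] [∀ n, Module.Finite R (D.X n)]
    (h : ∀ m : Ideal R, m.IsMaximal → ∃ (K : Type) (_ : Field K) (φ : R →+* K),
      RingHom.ker φ = m ∧ QuasiIso (((ModuleCat.extendScalars φ).mapHomologicalComplex
        (ComplexShape.down ℤ)).map f)) :
    QuasiIso f := by
  refine (quasiIso_iff_coneCycles_le_coneBoundaries f).2 fun n ↦
    Submodule.le_of_forall_isMaximal_exists_sub_smul_mem fun m hm z hz ↦ ?_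
  obtain ⟨K, _, φ, rfl, hK⟩ := h m hm
  obtain ⟨p, hp⟩ := (IsPrincipalIdealRing.principal (RingHom.ker φ)).principal
  obtain ⟨e, he⟩ := Submodule.exists_sub_smul_mem_of_forall_semilinearMap φ hp
    (coneBoundaries f n) z
    fun g hg ↦ semilinearMap_apply_eq_zero_of_quasiIso_extendScalars f n φ hK g hg hz
  obtain rfl | hp0 := eq_or_ne p 0
  · exact ⟨0, zero_mem _, 0, zero_mem _, by simpa using he⟩
  refine ⟨p, hp ▸ Ideal.mem_span_singleton_self p, e, ?_, he⟩
  have hpe : p • e ∈ coneCycles f n := by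
    simpa using sub_mem hz (coneBoundaries_le_coneCycles f n he)
  obtain ⟨h₁, h₂⟩ := (mem_coneCycles f n).1 hpe
  refine (mem_coneCycles f n).2 ⟨?_, ?_⟩
  · rw [Prod.smul_fst, map_smul] at h₁
    exact (smul_eq_zero.1 h₁).resolve_left hp0
  · rw [Prod.smul_fst, Prod.smul_snd, map_smul, map_smul] at h₂
    exact smul_right_injective _ hp0 h₂

end ChainComplex

theorem quasiIso_int_of_quasiIso_all_algClosed_base_changes
    (C D : ChainComplex (ModuleCat ℤ) ℤ)
    (hCbdd : ∃ a b : ℤ, ∀ n : ℤ, (n < a ∨ b < n) → Limits.IsZero (C.X n))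
    (hDbdd : ∃ a b : ℤ, ∀ n : ℤ, (n < a ∨ b < n) → Limits.IsZero (D.X n))
    (hCfree : ∀ n : ℤ, Module.Free ℤ (C.X n)) (hCfin : ∀ n : ℤ, Module.Finite ℤ (C.X n))
    (hDfree : ∀ n : ℤ, Module.Free ℤ (D.X n)) (hDfin : ∀ n : ℤ, Module.Finite ℤ (D.X n))
    (f : C ⟶ D)
    (hK : ∀ (K : Type) [Field K] [IsAlgClosed K],
      QuasiIso (((ModuleCat.extendScalars
        (Int.castRingHom K)).mapHomologicalComplex (ComplexShape.down ℤ)).map f)) :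
    QuasiIso f := by
  refine ChainComplex.quasiIso_of_quasiIso_extendScalars f fun m hm ↦ ?_
  let : Field (ℤ ⧸ m) := Ideal.Quotient.field m
  let K := AlgebraicClosure (ℤ ⧸ m)
  refine ⟨K, inferInstance, Int.castRingHom K, ?_, hK K⟩
  rw [RingHom.ext_int (Int.castRingHom K)
    ((algebraMap (ℤ ⧸ m) K).comp (Ideal.Quotient.mk m)), RingHom.ker_comp_of_injective _
    (algebraMap (ℤ ⧸ m) K).injective, Ideal.mk_ker]
end

section
/- A bounded chain complex C of finitely generated free ℤ-modules is acyclic if and only if C ⊗ K is acyclic for every algebraically closed field K. -/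
open CategoryTheory

universe u

theorem LinearMap.exists_comp_comp_self_eq {R A B C : Type*} [CommRing R] [IsDomain R]
    [IsPrincipalIdealRing R] [AddCommGroup A] [Module R A] [AddCommGroup B] [Module R B]
    [AddCommGroup C] [Module R C] [Module.Free R B] [Module.Finite R B]
    [Module.Free R C] [Module.Finite R C]
    {f : A →ₗ[R] B} {g : B →ₗ[R] C} (h : Function.Exact f g) :
    ∃ s : B →ₗ[R] A, f ∘ₗ s ∘ₗ f = f := by
  obtain ⟨σ, hσ⟩ := Module.projective_lifting_property f.rangeRestrict LinearMap.id
    f.surjective_rangeRestrict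
  obtain ⟨t, ht⟩ := Module.projective_lifting_property g.rangeRestrict LinearMap.id
    g.surjective_rangeRestrict
  have hr : ∀ x, (LinearMap.id - t ∘ₗ g.rangeRestrict : B →ₗ[R] B) x ∈
      LinearMap.range f := fun x ↦ by
    refine (h _).1 ?_
    simpa [sub_eq_zero] using
      (congr_arg Subtype.val (LinearMap.congr_fun ht (g.rangeRestrict x))).symm
  refine ⟨σ ∘ₗ (LinearMap.id - t ∘ₗ g.rangeRestrict : B →ₗ[R] B).codRestrict _ hr,
    LinearMap.ext fun a ↦ ?_⟩
  have h0 : g.rangeRestrict (f a) = 0 := Subtype.ext (h.apply_apply_eq_zero a)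
  simpa [h0] using congr_arg Subtype.val (LinearMap.congr_fun hσ
    ((LinearMap.id - t ∘ₗ g.rangeRestrict : B →ₗ[R] B).codRestrict _ hr (f a)))

theorem LinearMap.exists_comp_add_comp_eq_id {R A B C D : Type*} [CommRing R] [IsDomain R]
    [IsPrincipalIdealRing R] [AddCommGroup A] [Module R A] [AddCommGroup B] [Module R B]
    [AddCommGroup C] [Module R C] [AddCommGroup D] [Module R D]
    [Module.Free R B] [Module.Finite R B]
    [Module.Free R C] [Module.Finite R C] [Module.Free R D] [Module.Finite R D]
    {f : A →ₗ[R] B} {g : B →ₗ[R] C} {e : C →ₗ[R] D}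
    (hfg : Function.Exact f g) (hge : Function.Exact g e) :
    ∃ (s : B →ₗ[R] A) (t : C →ₗ[R] B), f ∘ₗ s + t ∘ₗ g = LinearMap.id := by
  obtain ⟨s, hs⟩ := exists_comp_comp_self_eq hfg
  obtain ⟨t, ht⟩ := exists_comp_comp_self_eq hge
  refine ⟨s ∘ₗ (LinearMap.id - t ∘ₗ g), t, LinearMap.ext fun x ↦ ?_⟩
  obtain ⟨a, ha⟩ := (hfg (x - t (g x))).1 <| by
    simpa [sub_eq_zero] using (LinearMap.congr_fun ht x).symm
  have := LinearMap.congr_fun hs a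
  simp only [LinearMap.comp_apply, ha] at this
  simp only [LinearMap.add_apply, LinearMap.comp_apply, LinearMap.sub_apply, LinearMap.id_apply,
    this, sub_add_cancel]

theorem Submodule.eq_top_of_forall_isMaximal_sup_smul_top_eq_top {R M : Type*} [CommRing R]
    [AddCommGroup M] [Module R M] [Module.Finite R M] (N : Submodule R M)
    (h : ∀ I : Ideal R, I.IsMaximal → N ⊔ I • (⊤ : Submodule R M) = ⊤) : N = ⊤ := by
  by_contra hN
  obtain ⟨P, hP, hNP⟩ := (eq_top_or_exists_le_coatom N).resolve_left hN
  obtain ⟨I, hI, ⟨φ⟩⟩ := isSimpleModule_iff_quot_maximal.1 (isSimpleModule_iff_isCoatom.2 hP)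
  refine hP.1 (top_le_iff.1 ((h I hI).ge.trans (sup_le hNP (Submodule.smul_le.2 ?_))))
  intro r hr x _
  rw [← Submodule.Quotient.mk_eq_zero, Submodule.Quotient.mk_smul]
  apply φ.injective
  obtain ⟨a, ha⟩ := Ideal.Quotient.mk_surjective (φ (Submodule.Quotient.mk x))
  rw [map_smul, map_zero, ← ha]
  exact Ideal.Quotient.eq_zero_iff_mem.2 (I.mul_mem_right _ hr)

theorem Submodule.mem_sup_ker_smul_top_of_forall_semilinearMap {R K M : Type*} [CommRing R]
    [Field K] [AddCommGroup M] [Module R M] (φ : R →+* K) [(RingHom.ker φ).IsMaximal]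
    (N : Submodule R M) (m : M)
    (h : ∀ g : M →ₛₗ[φ] K, (∀ x ∈ N, g x = 0) → g m = 0) :
    m ∈ N ⊔ RingHom.ker φ • (⊤ : Submodule R M) := by
  set P : Submodule R M := N ⊔ RingHom.ker φ • (⊤ : Submodule R M)
  have hP : Module.IsTorsionBySet R (M ⧸ P) (RingHom.ker φ : Set R) := by
    rintro x ⟨r, hr⟩
    obtain ⟨x, rfl⟩ := Submodule.Quotient.mk_surjective _ x
    exact (Submodule.Quotient.mk_eq_zero _).2
      (Submodule.mem_sup_right (Submodule.smul_mem_smul hr Submodule.mem_top))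
  let : Field (R ⧸ RingHom.ker φ) := Ideal.Quotient.field _
  let : Module (R ⧸ RingHom.ker φ) (M ⧸ P) := hP.module
  rw [← Submodule.Quotient.mk_eq_zero,
    ← Module.forall_dual_apply_eq_zero_iff (R ⧸ RingHom.ker φ)]
  intro ψ
  let g : M →ₛₗ[φ] K :=
    { toFun x := RingHom.kerLift φ (ψ (Submodule.Quotient.mk x))
      map_add' x y := by rw [Submodule.Quotient.mk_add, map_add, map_add]
      map_smul' r x := by
        rw [Submodule.Quotient.mk_smul, ← hP.mk_smul r, map_smul, smul_eq_mul, map_mul]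
        rfl }
  refine RingHom.kerLift_injective φ ((h g fun x hx ↦ ?_).trans (map_zero _).symm)
  change RingHom.kerLift φ (ψ (Submodule.Quotient.mk x)) = 0
  rw [(Submodule.Quotient.mk_eq_zero P).2 (Submodule.mem_sup_left hx), map_zero, map_zero]

theorem LinearMap.exact_of_forall_isMaximal {R A B C : Type*} [CommRing R] [IsDomain R]
    [IsPrincipalIdealRing R] (hR : ¬ IsField R) [AddCommGroup A] [Module R A] [AddCommGroup B]
    [Module R B] [AddCommGroup C] [Module R C] [Module.Finite R B] [Module.IsTorsionFree R C]
    {f : A →ₗ[R] B} {g : B →ₗ[R] C} (hgf : g ∘ₗ f = 0)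
    (h : ∀ I : Ideal R, I.IsMaximal → ∀ z, g z = 0 →
      z ∈ LinearMap.range f ⊔ I • (⊤ : Submodule R B)) :
    Function.Exact f g := by
  have htop : (LinearMap.range f).comap (LinearMap.ker g).subtype = ⊤ := by
    refine Submodule.eq_top_of_forall_isMaximal_sup_smul_top_eq_top _ fun I hI ↦
      Submodule.eq_top_iff'.2 fun z ↦ ?_
    obtain ⟨a, rfl⟩ := (IsPrincipalIdealRing.principal I).principal
    have ha : a ≠ 0 := by
      rintro rfl
      exact Ring.ne_bot_of_isMaximal_of_not_isField hI hR (by simp)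
    have hz := h _ hI z z.2
    rw [Ideal.submodule_span_eq, Submodule.ideal_span_singleton_smul] at hz
    obtain ⟨_, ⟨y, rfl⟩, _, ⟨w, -, rfl⟩, hyw⟩ := Submodule.mem_sup.1 hz
    have hw : g w = 0 := by
      have := congr_arg g hyw
      rw [map_add, z.2, ← LinearMap.comp_apply, hgf, LinearMap.zero_apply, zero_add] at this
      exact (smul_eq_zero.1 ((map_smul g a w).symm.trans this)).resolve_left ha
    refine Submodule.mem_sup.2 ⟨⟨f y, LinearMap.congr_fun hgf y⟩, ⟨y, rfl⟩,
      a • (⟨w, hw⟩ : LinearMap.ker g),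
      Submodule.smul_mem_smul (Submodule.mem_span_singleton_self a) Submodule.mem_top,
      Subtype.ext hyw⟩
  refine fun z ↦ ⟨fun hz ↦ ?_, ?_⟩
  · have : (⟨z, hz⟩ : LinearMap.ker g) ∈ (LinearMap.range f).comap (LinearMap.ker g).subtype :=
      htop ▸ Submodule.mem_top
    exact this
  · rintro ⟨y, rfl⟩
    exact LinearMap.congr_fun hgf y

theorem ModuleCat.isZero_homology_iff_exact {R : Type*} [Ring R] (C : ChainComplex (ModuleCat R) ℤ)
    (n : ℤ) : Limits.IsZero (C.homology n) ↔
      Function.Exact (C.d (n + 1) n).hom (C.d n (n - 1)).hom := by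
  rw [← HomologicalComplex.exactAt_iff_isZero_homology,
    C.exactAt_iff' (n + 1) n (n - 1) (by simp) (by simp)]
  exact ShortComplex.ShortExact.moduleCat_exact_iff_function_exact _

theorem ModuleCat.extendScalars_additive {R S : Type} [CommRing R] [CommRing S] (φ : R →+* S) :
    (ModuleCat.extendScalars.{0, 0, u} φ).Additive :=
  (ModuleCat.extendRestrictScalarsAdj.{u, 0, 0} φ).left_adjoint_additive

/-- If `1 ⊗ m` is in the range of the base change of `f`, then `m` is killed by every
map to a restriction of scalars which kills the range of `f`. -/
theorem ModuleCat.eq_zero_of_unit_mem_range_extendScalars_map {R S : Type} [CommRing R]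
    [CommRing S] (φ : R →+* S) {M N : ModuleCat.{u} R} (f : M ⟶ N) (m : N)
    (hm : ((ModuleCat.extendRestrictScalarsAdj φ).unit.app N).hom m ∈
      Set.range ((ModuleCat.extendScalars φ).map f).hom)
    {Y : ModuleCat.{u} S} (g : N ⟶ (ModuleCat.restrictScalars φ).obj Y) (hg : f ≫ g = 0) :
    g.hom m = 0 := by
  have := ModuleCat.extendScalars_additive.{u} φ
  let adj := ModuleCat.extendRestrictScalarsAdj.{u, 0, 0} φ
  let G := (adj.homEquiv N Y).symm g
  have hG : (ModuleCat.extendScalars φ).map f ≫ G = 0 := by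
    rw [← adj.homEquiv_naturality_left_symm, hg, adj.homEquiv_counit, Functor.map_zero,
      Limits.zero_comp]
  have hgG : g = adj.unit.app N ≫ (ModuleCat.restrictScalars φ).map G :=
    ((adj.homEquiv N Y).apply_symm_apply g).symm.trans (adj.homEquiv_unit _ _ _)
  obtain ⟨w, hw⟩ := hm
  rw [hgG]
  change G.hom ((adj.unit.app N).hom m) = 0
  rw [← hw]
  exact LinearMap.congr_fun (congr_arg ModuleCat.Hom.hom hG) w

theorem isZero_homology_extendScalars_of_isZero_homology {R K : Type} [CommRing R] [IsDomain R]
    [IsPrincipalIdealRing R] [CommRing K] (φ : R →+* K) (C : ChainComplex (ModuleCat.{u} R) ℤ)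
    [∀ n, Module.Free R (C.X n)] [∀ n, Module.Finite R (C.X n)]
    (h : ∀ n, Limits.IsZero (C.homology n)) (n : ℤ) :
    Limits.IsZero ((((ModuleCat.extendScalars φ).mapHomologicalComplex
      (ComplexShape.down ℤ)).obj C).homology n) := by
  have := ModuleCat.extendScalars_additive.{u} φ
  have h0 := (ModuleCat.isZero_homology_iff_exact C n).1 (h n)
  have h1 := (ModuleCat.isZero_homology_iff_exact C (n - 1)).1 (h (n - 1))
  rw [sub_add_cancel] at h1
  obtain ⟨s, t, hst⟩ := LinearMap.exists_comp_add_comp_eq_id h0 h1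
  have hid : ModuleCat.ofHom s ≫ C.d (n + 1) n + C.d n (n - 1) ≫ ModuleCat.ofHom t = 𝟙 _ :=
    ModuleCat.hom_ext hst
  rw [ModuleCat.isZero_homology_iff_exact]
  set F := ModuleCat.extendScalars.{0, 0, u} φ
  replace hid := congr_arg F.map hid
  rw [F.map_add, F.map_comp, F.map_comp, F.map_id] at hid
  intro x
  constructor
  · intro hx
    have hx' := LinearMap.congr_fun (congr_arg ModuleCat.Hom.hom hid) x
    refine ⟨(F.map (ModuleCat.ofHom s)).hom x, ?_⟩
    replace hx : (F.map (C.d n (n - 1))).hom x = 0 := hx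
    change (F.map (C.d (n + 1) n)).hom ((F.map (ModuleCat.ofHom s)).hom x) +
      (F.map (ModuleCat.ofHom t)).hom ((F.map (C.d n (n - 1))).hom x) = x at hx'
    rw [hx, map_zero, add_zero] at hx'
    exact hx'
  · rintro ⟨y, rfl⟩
    exact LinearMap.congr_fun (congr_arg ModuleCat.Hom.hom
      (((F.mapHomologicalComplex (ComplexShape.down ℤ)).obj C).d_comp_d (n + 1) n (n - 1))) y

/-- If the base change of `C` along `φ` is exact at `n`, then cycles in degree `n` are boundaries
modulo the kernel of `φ`. -/
theorem mem_range_d_sup_ker_smul_top {R K : Type} [CommRing R] [Field K] (φ : R →+* K)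
    [(RingHom.ker φ).IsMaximal] (C : ChainComplex (ModuleCat.{u} R) ℤ) (n : ℤ)
    (h : Limits.IsZero ((((ModuleCat.extendScalars φ).mapHomologicalComplex
      (ComplexShape.down ℤ)).obj C).homology n))
    (z : C.X n) (hz : (C.d n (n - 1)).hom z = 0) :
    z ∈ LinearMap.range (C.d (n + 1) n).hom ⊔ RingHom.ker φ • (⊤ : Submodule R (C.X n)) := by
  rw [ModuleCat.isZero_homology_iff_exact] at h
  refine Submodule.mem_sup_ker_smul_top_of_forall_semilinearMap φ _ z fun g hg ↦ ?_
  let adj := ModuleCat.extendRestrictScalarsAdj.{u, 0, 0} φ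
  let Y : ModuleCat.{u} K := ModuleCat.of K (ULift.{u} K)
  let g' : C.X n ⟶ (ModuleCat.restrictScalars φ).obj Y :=
    ModuleCat.ofHom (Y := (ModuleCat.restrictScalars φ).obj Y)
    { toFun x := (ULift.up (g x) : ULift.{u} K)
      map_add' x y := by rw [map_add]; rfl
      map_smul' r x := by rw [map_smulₛₗ]; rfl }
  refine congr_arg ULift.down (ModuleCat.eq_zero_of_unit_mem_range_extendScalars_map
    φ (C.d (n + 1) n) z ((h _).1 ?_) g' ?_)
  · refine (LinearMap.congr_fun (congr_arg ModuleCat.Hom.hom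
      (adj.unit.naturality (C.d n (n - 1)))) z).symm.trans ?_
    change (adj.unit.app _).hom ((C.d n (n - 1)).hom z) = 0
    rw [hz, map_zero]
  · ext x
    exact congr_arg ULift.up (hg _ ⟨x, rfl⟩)

theorem Int.ker_castRingHom_eq_of_quotient_ringHom {K : Type*} [Ring K] [Nontrivial K]
    {I : Ideal ℤ} (hI : I.IsMaximal) (j : ℤ ⧸ I →+* K) :
    RingHom.ker (Int.castRingHom K) = I := by
  refine (hI.eq_of_le (RingHom.ker_ne_top _) fun r hr ↦ ?_).symm
  rw [RingHom.ext_int (Int.castRingHom K) (j.comp (Ideal.Quotient.mk I)), RingHom.mem_ker,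
    RingHom.comp_apply, Ideal.Quotient.eq_zero_iff_mem.2 hr, map_zero]

/-- A bounded chain complex `C` of finitely generated free `ℤ`-modules is
acyclic if and only if `C ⊗ K` is acyclic for every algebraically closed field `K`. -/
theorem acyclic_iff_acyclic_all_algClosed_base_changes
    (C : ChainComplex (ModuleCat ℤ) ℤ)
    (hCbdd : ∃ a b : ℤ, ∀ n : ℤ, (n < a ∨ b < n) → Limits.IsZero (C.X n))
    (hCfree : ∀ n : ℤ, Module.Free ℤ (C.X n)) (hCfin : ∀ n : ℤ, Module.Finite ℤ (C.X n)) :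
    (∀ n : ℤ, Limits.IsZero (C.homology n)) ↔
      (∀ (K : Type) [Field K] [IsAlgClosed K], ∀ n : ℤ,
        Limits.IsZero ((((ModuleCat.extendScalars
          (Int.castRingHom K)).mapHomologicalComplex
            (ComplexShape.down ℤ)).obj C).homology n)) := by
  refine ⟨fun h K _ _ n ↦ isZero_homology_extendScalars_of_isZero_homology _ C h n, fun h n ↦ ?_⟩
  rw [ModuleCat.isZero_homology_iff_exact]
  refine LinearMap.exact_of_forall_isMaximal Int.not_isField
    (congr_arg ModuleCat.Hom.hom (C.d_comp_d (n + 1) n (n - 1))) fun I hI z hz ↦ ?_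
  let := Ideal.Quotient.field I
  have hker := Int.ker_castRingHom_eq_of_quotient_ringHom hI
    (algebraMap (ℤ ⧸ I) (AlgebraicClosure (ℤ ⧸ I)))
  have : (RingHom.ker (Int.castRingHom (AlgebraicClosure (ℤ ⧸ I)))).IsMaximal := by rwa [hker]
  have := mem_range_d_sup_ker_smul_top _ C n (h (AlgebraicClosure (ℤ ⧸ I)) n) z hz
  rwa [hker] at this
end
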